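/- Let c > 0 and 0 < β < c, and for each natural number n ≥ 0 define K_n = c·∫_ℝ exp((β − c)·τ)/(1 + exp(−c·τ))^{n+2} dτ. Then each K_n converges, K₀ = π·β/(c·sin(π·β/c)), and K_{n+1} = ((n+1)·c + β)/((n+2)·c) · K_n for all n ≥ 0. -/

import Mathlib

open MeasureTheory

lemma beta_aux (u v : ℝ) (hu : 0 < u) (hv : 0 < v) :
    IntegrableOn (fun x : ℝ => x ^ (u - 1) * (1 - x) ^ (v - 1)) (Set.Ioo 0 1) ∧
    ∫ x in Set.Ioo (0:ℝ) 1, x ^ (u - 1) * (1 - x) ^ (v - 1) =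
      Real.Gamma u * Real.Gamma v / Real.Gamma (u + v) := by
  have h1 := Complex.betaIntegral_convergent (u := u) (v := v) (by simpa) (by simpa)
  rw [intervalIntegrable_iff_integrableOn_Ioo_of_le zero_le_one] at h1
  have hcongr : Set.EqOn (fun x : ℝ => (x : ℂ) ^ ((u : ℂ) - 1) * (1 - (x : ℂ)) ^ ((v : ℂ) - 1))
      (fun x : ℝ => ((x ^ (u - 1) * (1 - x) ^ (v - 1) : ℝ) : ℂ)) (Set.Ioo 0 1) := by
    intro x hx
    have h0 : 0 ≤ x := hx.1.le
    have h2 : 0 ≤ 1 - x := by linarith [hx.2]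
    simp only [Complex.ofReal_mul, Complex.ofReal_cpow h0, Complex.ofReal_cpow h2]
    push_cast
    rfl
  constructor
  · rw [integrableOn_congr_fun hcongr measurableSet_Ioo] at h1
    have := h1.re
    simpa [IntegrableOn] using this
  · have h3 := ProbabilityTheory.beta_eq_betaIntegralReal u v hu hv
    rw [ProbabilityTheory.beta] at h3
    rw [h3, Complex.betaIntegral, intervalIntegral.integral_of_le zero_le_one,
      integral_Ioc_eq_integral_Ioo, setIntegral_congr_fun measurableSet_Ioo hcongr,
      integral_complex_ofReal, Complex.ofReal_re]

lemma pw_aux (c β : ℝ) (hc : 0 < c) (n : ℕ) (τ : ℝ) :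
    (Real.sigmoid (c * τ) * (1 - Real.sigmoid (c * τ)) * c) *
      (Real.sigmoid (c * τ) ^ ((n + 1 + β / c) - 1) *
        (1 - Real.sigmoid (c * τ)) ^ ((1 - β / c) - 1)) =
    c * (Real.exp ((β - c) * τ) / (1 + Real.exp (-c * τ)) ^ (n + 2)) := by
  have hs := Real.sigmoid_pos (c * τ)
  have h1 : 1 - Real.sigmoid (c * τ) = Real.sigmoid (c * τ) * Real.exp (-c * τ) := by
    rw [← Real.sigmoid_neg, ← Real.sigmoid_mul_rexp_neg, neg_mul]
  have h2 : (1 + Real.exp (-c * τ)) = (Real.sigmoid (c * τ))⁻¹ := by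
    rw [Real.sigmoid_def, inv_inv, neg_mul]
  rw [h1, h2, Real.mul_rpow hs.le (Real.exp_pos _).le, ← Real.exp_mul]
  have h3 : (n + 1 + β / c) - 1 = (n : ℝ) + β / c := by ring
  have h4 : (1 - β / c) - 1 = - (β / c) := by ring
  have h5 : -c * τ * -(β / c) = β * τ := by field_simp
  have h6 : Real.exp ((β - c) * τ) = Real.exp (β * τ) * Real.exp (-c * τ) := by
    rw [← Real.exp_add]; ring_nf
  rw [h3, h4, h5, h6, Real.rpow_add hs, Real.rpow_neg hs.le, Real.rpow_natCast, inv_pow]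
  have := (Real.rpow_pos_of_pos hs (β / c)).ne'
  field_simp
  ring

lemma K_aux (c β : ℝ) (hc : 0 < c) (hβ : 0 < β) (hβc : β < c) (n : ℕ) :
    Integrable (fun τ : ℝ => Real.exp ((β - c) * τ) / (1 + Real.exp (-c * τ)) ^ (n + 2)) ∧
    c * ∫ τ : ℝ, Real.exp ((β - c) * τ) / (1 + Real.exp (-c * τ)) ^ (n + 2) =
      Real.Gamma (n + 1 + β / c) * Real.Gamma (1 - β / c) / Real.Gamma (n + 2) := by
  have ha : 0 < β / c := div_pos hβ hc
  have ha1 : 0 < 1 - β / c := by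
    rw [sub_pos, div_lt_one hc]; exact hβc
  obtain ⟨hI, hE⟩ := beta_aux (n + 1 + β / c) (1 - β / c) (by positivity) ha1
  have hd : ∀ x ∈ (Set.univ : Set ℝ), HasDerivWithinAt (fun τ => Real.sigmoid (c * τ))
      (Real.sigmoid (c * x) * (1 - Real.sigmoid (c * x)) * c) Set.univ x := by
    intro x _
    have := (Real.hasDerivAt_sigmoid (c * x)).comp x ((hasDerivAt_id x).const_mul c)
    simpa [Function.comp_def] using this
  have hm : MonotoneOn (fun τ => Real.sigmoid (c * τ)) Set.univ := by
    intro x _ y _ h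
    exact Real.sigmoid_le (mul_le_mul_of_nonneg_left h hc.le)
  have him : (fun τ => Real.sigmoid (c * τ)) '' Set.univ = Set.Ioo 0 1 := by
    rw [Set.image_univ, ← Real.range_sigmoid]
    exact (mul_left_surjective₀ hc.ne').range_comp Real.sigmoid
  rw [← him, integrableOn_image_iff_integrableOn_deriv_smul_of_monotoneOn
    MeasurableSet.univ hd hm] at hI
  rw [← him, integral_image_eq_integral_deriv_smul_of_monotoneOn MeasurableSet.univ hd hm] at hE
  simp only [smul_eq_mul, pw_aux c β hc n, integrableOn_univ, setIntegral_univ] at hI hE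
  rw [integral_const_mul] at hE
  refine ⟨?_, ?_⟩
  · have := hI.const_mul c⁻¹
    simpa [inv_mul_cancel_left₀ hc.ne'] using this
  · rw [hE]; congr 2; ring

/-- The integrals `K_n = c ∫_ℝ e^{(β−c)τ}/(1+e^{−cτ})^{n+2} dτ` converge, with
`K₀ = πβ/(c sin(πβ/c))` and the recurrence `K_{n+1} = ((n+1)c + β)/((n+2)c) · K_n`. -/
theorem melnikov_K_integral_recurrence (c β : ℝ) (hc : 0 < c) (hβ : 0 < β) (hβc : β < c) :
    let K : ℕ → ℝ := fun n =>
      c * ∫ τ : ℝ, Real.exp ((β - c) * τ) / (1 + Real.exp (-c * τ)) ^ (n + 2)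
    (∀ n : ℕ,
      Integrable
        (fun τ : ℝ => Real.exp ((β - c) * τ) / (1 + Real.exp (-c * τ)) ^ (n + 2))) ∧
    K 0 = Real.pi * β / (c * Real.sin (Real.pi * β / c)) ∧
    (∀ n : ℕ, K (n + 1) = (((n : ℝ) + 1) * c + β) / (((n : ℝ) + 2) * c) * K n) := by
  intro K
  have hK : ∀ n : ℕ, K n =
      Real.Gamma (n + 1 + β / c) * Real.Gamma (1 - β / c) / Real.Gamma (n + 2) :=
    fun n => (K_aux c β hc hβ hβc n).2
  have ha : 0 < β / c := div_pos hβ hc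
  refine ⟨fun n => (K_aux c β hc hβ hβc n).1, ?_, ?_⟩
  · rw [hK 0]
    have h1 : ((0 : ℕ) : ℝ) + 1 + β / c = β / c + 1 := by push_cast; ring
    have h2 : Real.Gamma (((0 : ℕ) : ℝ) + 2) = 1 := by simp
    rw [h1, h2, Real.Gamma_add_one ha.ne', mul_assoc, Real.Gamma_mul_Gamma_one_sub, div_one,
      ← mul_div_assoc Real.pi, div_mul_div_comm, mul_comm β]
  · intro n
    rw [hK, hK]
    have h1 : ((n + 1 : ℕ) : ℝ) + 1 + β / c = (n + 1 + β / c) + 1 := by push_cast; ring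
    have h2 : ((n + 1 : ℕ) : ℝ) + 2 = (n + 2) + 1 := by push_cast; ring
    have h3 : Real.Gamma ((n : ℝ) + 2) ≠ 0 := (Real.Gamma_pos_of_pos (by positivity)).ne'
    rw [h1, h2, Real.Gamma_add_one (by positivity), Real.Gamma_add_one (by positivity)]
    have h4 : (n : ℝ) + 1 + β / c = ((n + 1) * c + β) / c := by field_simp
    generalize Real.Gamma ((n : ℝ) + 1 + β / c) = G
    rw [h4]
    field_simp
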